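/- arXiv:1702.07505 — 11 statements merged into one kernel-verified Lean document; each statement's English description precedes it below -/
import Mathlib

section
/- Let q ∈ ℝ^N and let u be a subgradient of g* at q. Then u_j = 0 for every index j with |q_j| < max_{1≤i≤N} |q_i|. In particular, if the maximum of |q_i| is attained at a unique index j, then u_i = 0 for all i ≠ j and u_j = q_j/α, so u has at most one nonzero component. -/
open scoped RealInnerProductSpace

/-- A subgradient's `j`-th component is the derivative at `0` of any function that touches
`t ↦ g (q + t e_j)` from above at `t = 0`. -/
theorem subgradient_apply_eq_of_hasDerivAt_of_le {ι : Type*} [Fintype ι] [DecidableEq ι]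
    {g : EuclideanSpace ℝ ι → ℝ} {q u : EuclideanSpace ℝ ι}
    (hu : ∀ w, g w ≥ g q + ⟪u, w - q⟫) {j : ι} {f : ℝ → ℝ} {f' : ℝ}
    (hf : HasDerivAt f f' 0) (hf0 : f 0 = g q)
    (hle : ∀ᶠ t in nhds 0, g (q + EuclideanSpace.single j t) ≤ f t) : u j = f' := by
  have hmin : IsLocalMin (fun t => f t - t * u j) 0 := by
    filter_upwards [hle] with t ht
    have h := hu (q + EuclideanSpace.single j t)
    simp only [add_sub_cancel_left, EuclideanSpace.inner_single_right, conj_trivial] at h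
    simp only [zero_mul, sub_zero]
    linarith
  have h := hmin.hasDerivAt_eq_zero (hf.sub ((hasDerivAt_id (0 : ℝ)).mul_const (u j)))
  linarith

/-- Any subgradient `u` of `g*(q) = (1/(2α)) max_i (q i)²` vanishes on the
components where `|q j| < max_i |q i|`; if the maximum is attained at a unique
index `j`, then `u` has at most one nonzero component: `u i = 0` for `i ≠ j`
and `u j = q j / α`. -/
theorem subgradient_of_conjugate_switching_penalty_sparsity
    (N : ℕ) (hN : 0 < N) (α : ℝ) (hα : 0 < α)
    (q u : EuclideanSpace ℝ (Fin N))
    (hu : ∀ w : EuclideanSpace ℝ (Fin N),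
        1 / (2 * α) * (⨆ i, (w i) ^ 2) ≥
          1 / (2 * α) * (⨆ i, (q i) ^ 2) + ⟪u, w - q⟫) :
    (∀ j, |q j| < (⨆ i, |q i|) → u j = 0) ∧
      (∀ j, (∀ i, i ≠ j → |q i| < |q j|) →
        (∀ i, i ≠ j → u i = 0) ∧ u j = q j / α) := by
  have : Nonempty (Fin N) := ⟨⟨0, hN⟩⟩
  have hzero : ∀ j, |q j| < (⨆ i, |q i|) → u j = 0 := by
    intro j hj
    obtain ⟨k, hk⟩ := exists_eq_ciSup_of_finite (f := fun i => |q i|)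
    rw [← hk] at hj
    refine subgradient_apply_eq_of_hasDerivAt_of_le
      (g := fun w => 1 / (2 * α) * (⨆ i, (w i) ^ 2)) hu (hasDerivAt_const 0 _) rfl ?_
    have hcont : ContinuousAt (fun t : ℝ => (q j + t) ^ 2) 0 := by fun_prop
    filter_upwards [hcont.eventually_lt_const (u := q k ^ 2) (by simpa using sq_lt_sq.2 hj)]
      with t ht
    have hbdd : BddAbove (Set.range fun i => q i ^ 2) := (Set.finite_range _).bddAbove
    refine mul_le_mul_of_nonneg_left (ciSup_le fun i => ?_) (by positivity)
    rcases eq_or_ne i j with rfl | hij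
    · simpa using ht.le.trans (le_ciSup hbdd k)
    · simpa [hij] using le_ciSup hbdd i
  refine ⟨hzero, fun j hj => ⟨fun i hij => hzero i ((hj i hij).trans_le
    (le_ciSup (f := fun i => |q i|) (Set.finite_range _).bddAbove j)), ?_⟩⟩
  have hderiv : HasDerivAt (fun t : ℝ => 1 / (2 * α) * (q j + t) ^ 2) (q j / α) 0 := by
    refine HasDerivAt.congr_deriv
      ((((hasDerivAt_id (0 : ℝ)).const_add (q j)).pow 2).const_mul (1 / (2 * α))) ?_
    simp only [id, Nat.cast_ofNat, add_zero, Nat.add_one_sub_one, pow_one]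
    field_simp
  refine subgradient_apply_eq_of_hasDerivAt_of_le
    (g := fun w => 1 / (2 * α) * (⨆ i, (w i) ^ 2)) hu hderiv ?_ ?_
  · have hsup : (⨆ i, q i ^ 2) = q j ^ 2 := by
      refine le_antisymm (ciSup_le fun i => ?_)
        (le_ciSup (f := fun i => q i ^ 2) (Set.finite_range _).bddAbove j)
      rcases eq_or_ne i j with rfl | hij
      · exact le_rfl
      · exact (sq_lt_sq.2 (hj i hij)).le
    simp [hsup]
  · have hev : ∀ᶠ t in nhds (0 : ℝ), ∀ i, i ≠ j → q i ^ 2 < (q j + t) ^ 2 := by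
      refine Filter.eventually_all.2 fun i => Filter.eventually_imp_distrib_left.2 fun hij => ?_
      have hcont : ContinuousAt (fun t : ℝ => (q j + t) ^ 2) 0 := by fun_prop
      exact hcont.eventually_const_lt (by simpa using sq_lt_sq.2 (hj i hij))
    filter_upwards [hev] with t ht
    refine mul_le_mul_of_nonneg_left (ciSup_le fun i => ?_) (by positivity)
    rcases eq_or_ne i j with rfl | hij
    · simp
    · simpa [hij] using (ht i hij).le
end

section
/- Let q ∈ ℝ^N and let u be a subgradient of g* at q. Then ‖u‖₂ ≤ (1/α) max_{1≤i≤N} |q_i|; in particular ‖u‖₂ ≤ (1/α)‖q‖₂, so the set of subgradients of g* at points of a bounded set is uniformly bounded. -/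
open scoped RealInnerProductSpace

/-- Uniform bound on subgradients of `g*(q) = (1/(2α)) max_i (q i)²`:
any subgradient `u` at `q` satisfies `‖u‖₂ ≤ (1/α) max_i |q i|` and in
particular `‖u‖₂ ≤ (1/α) ‖q‖₂`. -/
theorem subgradient_of_conjugate_switching_penalty_bound
    (N : ℕ) (hN : 0 < N) (α : ℝ) (hα : 0 < α)
    (q u : EuclideanSpace ℝ (Fin N))
    (hu : ∀ w : EuclideanSpace ℝ (Fin N),
        1 / (2 * α) * (⨆ i, (w i) ^ 2) ≥
          1 / (2 * α) * (⨆ i, (q i) ^ 2) + ⟪u, w - q⟫) :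
    ‖u‖ ≤ 1 / α * (⨆ i, |q i|) ∧ ‖u‖ ≤ 1 / α * ‖q‖ := by
  have : Nonempty (Fin N) := ⟨⟨0, hN⟩⟩
  have coord_le (v : EuclideanSpace ℝ (Fin N)) (i : Fin N) : |v i| ≤ ‖v‖ := by
    simpa using PiLp.norm_apply_le v i
  have le_sup (i : Fin N) : |q i| ≤ ⨆ i, |q i| :=
    le_ciSup (f := fun i => |q i|) (Set.finite_range _).bddAbove i
  have sup_le : (⨆ i, |q i|) ≤ ‖q‖ := ciSup_le (coord_le q)
  have sq_le : (⨆ i, |q i|) ^ 2 ≤ ⨆ i, (q i) ^ 2 := by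
    obtain ⟨i, hi⟩ := exists_eq_ciSup_of_finite (f := fun i => |q i|)
    rw [← hi, sq_abs]
    exact le_ciSup (f := fun i => (q i) ^ 2) (Set.finite_range _).bddAbove i
  have key : ‖u‖ ≤ 1 / α * (⨆ i, |q i|) := by
    generalize (⨆ i, |q i|) = M at *
    have hM : 0 ≤ M := (abs_nonneg _).trans (le_sup ⟨0, hN⟩)
    rw [one_div_mul_eq_div, le_div_iff₀ hα]
    by_contra! hlt
    have hU : 0 < ‖u‖ := by
      by_contra! h
      nlinarith
    -- Perturb `q` by a small step in the direction of `u`.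
    set t := (‖u‖ * α - M) / ‖u‖ with ht
    have htU : t * ‖u‖ = ‖u‖ * α - M := div_mul_cancel₀ _ hU.ne'
    have htpos : 0 < t := div_pos (sub_pos.2 hlt) hU
    have hsup : (⨆ i, ((q + t • u) i) ^ 2) ≤ (M + t * ‖u‖) ^ 2 := by
      refine ciSup_le fun i => sq_le_sq' ?_ ?_ <;>
      · have h₁ := abs_le.1 (le_sup i)
        have h₂ := abs_le.1 (coord_le u i)
        simp only [PiLp.add_apply, PiLp.smul_apply, smul_eq_mul]
        nlinarith
    have h := hu (q + t • u)
    rw [add_sub_cancel_left, real_inner_smul_right, real_inner_self_eq_norm_sq] at h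
    have h' : (⨆ i, (q i) ^ 2) + 2 * α * (t * ‖u‖ ^ 2) ≤ ⨆ i, ((q + t • u) i) ^ 2 := by
      have h₂ := mul_le_mul_of_nonneg_left h (by positivity : 0 ≤ 2 * α)
      field_simp at h₂
      linarith
    have hquad : 2 * α * ‖u‖ * (t * ‖u‖) ≤ (2 * M + t * ‖u‖) * (t * ‖u‖) := by
      linarith
    have := le_of_mul_le_mul_right hquad (mul_pos htpos hU)
    linarith
  exact ⟨key, key.trans (by gcongr)⟩
end

section
/- Let q ∈ ℝ^N and suppose there is an index j such that |q_j| > (1 + γ/α)|q_i| for all i ≠ j. Then the unique minimizer w over z ∈ ℝ^N of z ↦ (1/(2γ))‖z − q‖₂² + (1/(2α)) max_{1≤i≤N} z_i² is given by w_j = (α/(α+γ)) q_j and w_i = q_i for i ≠ j. Consequently, the Moreau–Yosida regularized map u = (q − w)/γ satisfies u_j = q_j/(α+γ) and u_i = 0 for i ≠ j, so u has at most one nonzero component. -/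
/-- If `w` and `q` agree off the coordinate `j`, the three-point identity for the squared distance
only involves that coordinate. -/
lemma norm_sub_sq_eq_of_eq_off {ι : Type*} [Fintype ι] {w q : EuclideanSpace ℝ ι} {j : ι}
    (h : ∀ i, i ≠ j → w i = q i) (z : EuclideanSpace ℝ ι) :
    ‖z - q‖ ^ 2 = ‖z - w‖ ^ 2 + ‖w - q‖ ^ 2 + 2 * ((z j - w j) * (w j - q j)) := by
  have hinner : inner ℝ (z - w) (w - q) = (z j - w j) * (w j - q j) := by
    rw [PiLp.inner_apply, Finset.sum_eq_single j]
    · simp [mul_comm]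
    · intro i _ hi
      simp [h i hi]
    · simp
  rw [← sub_add_sub_cancel z w q, norm_add_sq_real, hinner]
  ring

/-- If one component of `q` strictly dominates: `|q j| > (1 + γ/α) |q i|` for
all `i ≠ j`, then the proximal point `w = prox_{γ g*}(q)` of
`g*(z) = (1/(2α)) max_i (z i)²` is given by `w j = (α/(α+γ)) q j`, `w i = q i`
for `i ≠ j`, and the Moreau–Yosida regularized map `u = (q - w)/γ` satisfies
`u j = q j/(α+γ)` and `u i = 0` for `i ≠ j` (at most one nonzero component). -/
theorem prox_of_conjugate_switching_penalty_single_active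
    (N : ℕ) (hN : 0 < N) (α γ : ℝ) (hα : 0 < α) (hγ : 0 < γ)
    (q : EuclideanSpace ℝ (Fin N)) (j : Fin N)
    (hj : ∀ i, i ≠ j → (1 + γ / α) * |q i| < |q j|)
    (w u : EuclideanSpace ℝ (Fin N))
    (hwj : w j = α / (α + γ) * q j) (hwi : ∀ i, i ≠ j → w i = q i)
    (hu : u = γ⁻¹ • (q - w)) :
    ((∀ z : EuclideanSpace ℝ (Fin N),
        1 / (2 * γ) * ‖w - q‖ ^ 2 + 1 / (2 * α) * (⨆ i, (w i) ^ 2) ≤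
          1 / (2 * γ) * ‖z - q‖ ^ 2 + 1 / (2 * α) * (⨆ i, (z i) ^ 2)) ∧
      (∀ z : EuclideanSpace ℝ (Fin N),
        1 / (2 * γ) * ‖z - q‖ ^ 2 + 1 / (2 * α) * (⨆ i, (z i) ^ 2) =
          1 / (2 * γ) * ‖w - q‖ ^ 2 + 1 / (2 * α) * (⨆ i, (w i) ^ 2) → z = w)) ∧
      u j = q j / (α + γ) ∧ ∀ i, i ≠ j → u i = 0 := by
  have hαγ : 0 < α + γ := by positivity
  have hsup : (⨆ i, (w i) ^ 2) = (w j) ^ 2 := by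
    have : Nonempty (Fin N) := ⟨j⟩
    refine le_antisymm (ciSup_le fun i => ?_)
      (le_ciSup (f := fun i => (w i) ^ 2) (Set.finite_range _).bddAbove j)
    by_cases hi : i = j
    · rw [hi]
    · rw [sq_le_sq, hwi i hi, hwj, abs_mul, abs_of_pos (div_pos hα hαγ), div_mul_eq_mul_div,
        le_div_iff₀ hαγ]
      calc |q i| * (α + γ) = α * ((1 + γ / α) * |q i|) := by field_simp
        _ ≤ α * |q j| := mul_le_mul_of_nonneg_left (hj i hi).le hα.le
  have growth : ∀ z : EuclideanSpace ℝ (Fin N),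
      1 / (2 * γ) * ‖w - q‖ ^ 2 + 1 / (2 * α) * (⨆ i, (w i) ^ 2) + 1 / (2 * γ) * ‖z - w‖ ^ 2 ≤
        1 / (2 * γ) * ‖z - q‖ ^ 2 + 1 / (2 * α) * (⨆ i, (z i) ^ 2) := by
    intro z
    have hz : 1 / (2 * α) * (z j) ^ 2 ≤ 1 / (2 * α) * (⨆ i, (z i) ^ 2) :=
      mul_le_mul_of_nonneg_left
        (le_ciSup (f := fun i => (z i) ^ 2) (Set.finite_range _).bddAbove j) (by positivity)
    have hcoord : 1 / (2 * γ) * (2 * ((z j - w j) * (w j - q j))) + 1 / (2 * α) * (z j) ^ 2 -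
        1 / (2 * α) * (w j) ^ 2 = 1 / (2 * α) * (z j - w j) ^ 2 := by
      rw [hwj]
      field_simp
      ring
    have hnonneg : 0 ≤ 1 / (2 * α) * (z j - w j) ^ 2 := by positivity
    rw [hsup, norm_sub_sq_eq_of_eq_off hwi z]
    linarith
  refine ⟨⟨fun z => ?_, fun z hz => ?_⟩, ?_, fun i hi => ?_⟩
  · have : 0 ≤ 1 / (2 * γ) * ‖z - w‖ ^ 2 := by positivity
    linarith [growth z]
  · have hle : 1 / (2 * γ) * ‖z - w‖ ^ 2 ≤ 0 := by linarith [growth z]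
    have hsq : ‖z - w‖ ^ 2 ≤ 0 := nonpos_of_mul_nonpos_right hle (by positivity)
    exact sub_eq_zero.mp (norm_eq_zero.mp (pow_eq_zero_iff two_ne_zero |>.mp
      (le_antisymm hsq (sq_nonneg _))))
  · rw [hu, PiLp.smul_apply, PiLp.sub_apply, hwj, smul_eq_mul]
    field_simp
    ring
  · simp [hu, hwi i hi]
end

section
/- Define the Moreau envelope e_γ : ℝ^N → ℝ by e_γ(q) = inf_{w ∈ ℝ^N} [(1/(2γ))‖w − q‖₂² + (1/(2α)) max_{1≤i≤N} w_i²]. Then for every v ∈ ℝ^N, the supremum over q ∈ ℝ^N of ⟨q, v⟩ − e_γ(q) equals (α/2)(∑_{i=1}^N |v_i|)² + (γ/2)‖v‖₂²; that is, the Fenchel conjugate of the Moreau envelope of g* equals g + (γ/2)‖·‖₂². -/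
open scoped RealInnerProductSpace

theorem EuclideanSpace.inner_le_sqrt_iSup_sq_mul_sum_abs {ι : Type*} [Fintype ι]
    (w v : EuclideanSpace ℝ ι) :
    ⟪w, v⟫ ≤ √(⨆ i, (w i) ^ 2) * ∑ i, |v i| := by
  rw [PiLp.inner_apply, Finset.mul_sum]
  refine Finset.sum_le_sum fun i _ => ?_
  have hw : |w i| ≤ √(⨆ i, (w i) ^ 2) :=
    Real.abs_le_sqrt (le_ciSup (f := fun i => (w i) ^ 2) (Set.finite_range _).bddAbove i)
  calc ⟪w i, v i⟫ ≤ |w i| * |v i| := by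
        simpa only [Real.norm_eq_abs] using real_inner_le_norm (w i) (v i)
    _ ≤ _ := mul_le_mul_of_nonneg_right hw (abs_nonneg _)

theorem mul_le_half_mul_sq_add {c : ℝ} (hc : 0 < c) (a b : ℝ) :
    a * b ≤ 1 / (2 * c) * a ^ 2 + c / 2 * b ^ 2 := by
  have h : 1 / (2 * c) * a ^ 2 + c / 2 * b ^ 2 - a * b = 1 / (2 * c) * (a - c * b) ^ 2 := by
    field_simp
    ring
  have : 0 ≤ 1 / (2 * c) * (a - c * b) ^ 2 := by positivity
  linarith

/-- The Fenchel–Young inequality for `(α/2) (∑ i, |v i|)²` and its conjugate. -/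
theorem EuclideanSpace.inner_le_iSup_sq_add_sum_abs_sq {ι : Type*} [Fintype ι] {α : ℝ}
    (hα : 0 < α) (w v : EuclideanSpace ℝ ι) :
    ⟪w, v⟫ ≤ 1 / (2 * α) * (⨆ i, (w i) ^ 2) + α / 2 * (∑ i, |v i|) ^ 2 := by
  have h := mul_le_half_mul_sq_add hα (√(⨆ i, (w i) ^ 2)) (∑ i, |v i|)
  rw [Real.sq_sqrt (Real.iSup_nonneg fun i => sq_nonneg _)] at h
  exact (inner_le_sqrt_iSup_sq_mul_sum_abs w v).trans h

/-- The Fenchel conjugate of the Moreau envelope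
`e_γ(q) = inf_w (1/(2γ)) ‖w - q‖² + (1/(2α)) max_i (w i)²` of
`g*(q) = (1/(2α)) max_i (q i)²` equals `g + (γ/2) ‖·‖₂²` where
`g(v) = (α/2) (∑ i, |v i|)²`. -/
theorem conjugate_of_moreau_envelope_switching_penalty
    (N : ℕ) (hN : 0 < N) (α γ : ℝ) (hα : 0 < α) (hγ : 0 < γ)
    (v : EuclideanSpace ℝ (Fin N)) :
    IsLUB
      (Set.range fun q : EuclideanSpace ℝ (Fin N) =>
        ⟪q, v⟫ - ⨅ w : EuclideanSpace ℝ (Fin N),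
            (1 / (2 * γ) * ‖w - q‖ ^ 2 + 1 / (2 * α) * ⨆ i, (w i) ^ 2))
      (α / 2 * (∑ i, |v i|) ^ 2 + γ / 2 * ‖v‖ ^ 2) := by
  have : Nonempty (Fin N) := ⟨⟨0, hN⟩⟩
  constructor
  · rintro _ ⟨q, rfl⟩
    dsimp only
    rw [sub_le_comm]
    refine le_ciInf fun w => ?_
    have hw := EuclideanSpace.inner_le_iSup_sq_add_sum_abs_sq hα w v
    have hq := (real_inner_le_norm (q - w) v).trans (mul_le_half_mul_sq_add hγ _ _)
    rw [inner_sub_left, norm_sub_rev] at hq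
    linarith
  · intro b hb
    set S := ∑ i, |v i| with hS
    let w : EuclideanSpace ℝ (Fin N) := WithLp.toLp 2 fun i => α * S * SignType.sign (v i)
    have hwv : ⟪w, v⟫ = α * S ^ 2 := by
      rw [PiLp.inner_apply, pow_two, ← mul_assoc]
      conv_rhs => rw [hS, Finset.mul_sum]
      refine Finset.sum_congr rfl fun i _ => ?_
      change v i * (α * S * SignType.sign (v i)) = α * S * |v i|
      rw [← sign_mul_self (v i)]
      ring
    have hw : ⨆ i, (w i) ^ 2 ≤ (α * S) ^ 2 := by
      refine ciSup_le fun i => ?_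
      change (α * S * SignType.sign (v i)) ^ 2 ≤ _
      rw [mul_pow]
      refine mul_le_of_le_one_right (sq_nonneg _) ?_
      rcases SignType.sign (v i) with _ | _ | _ <;> simp
    have hbdd : BddBelow (Set.range fun u : EuclideanSpace ℝ (Fin N) =>
        1 / (2 * γ) * ‖u - (w + γ • v)‖ ^ 2 + 1 / (2 * α) * ⨆ i, (u i) ^ 2) := by
      refine ⟨0, ?_⟩
      rintro _ ⟨u, rfl⟩
      have : 0 ≤ ⨆ i, (u i) ^ 2 := Real.iSup_nonneg fun i => sq_nonneg _
      positivity
    have hinf := ciInf_le hbdd w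
    have hq := hb ⟨w + γ • v, rfl⟩
    dsimp only at hq
    rw [inner_add_left, hwv, real_inner_smul_left, real_inner_self_eq_norm_sq] at hq
    have hnorm : 1 / (2 * γ) * ‖w - (w + γ • v)‖ ^ 2 = γ / 2 * ‖v‖ ^ 2 := by
      rw [sub_add_cancel_left, norm_neg, norm_smul, Real.norm_of_nonneg hγ.le]
      field_simp
    have hsup : 1 / (2 * α) * (⨆ i, (w i) ^ 2) ≤ α / 2 * S ^ 2 :=
      calc _ ≤ 1 / (2 * α) * (α * S) ^ 2 := by gcongr
        _ = _ := by field_simp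
    linarith
end

section
/- Let 0 < α < β and define g_β : ℝ² → ℝ by g_β(v) = ((α−β)/2)(v_1² + v_2²) + (β/2)(|v_1| + |v_2|)². Then for every q ∈ ℝ², the supremum over v ∈ ℝ² of ⟨q, v⟩ − g_β(v) equals (1/(2α)) max(q_1², q_2²); that is, the (nonconvex) function g_β has the same Fenchel conjugate as g(v) = (α/2)(|v_1| + |v_2|)². -/
open scoped RealInnerProductSpace

/-- For `0 < α < β`, the nonconvex function
`g_β(v) = ((α-β)/2)(v₁² + v₂²) + (β/2)(|v₁| + |v₂|)²` on `ℝ²` has the same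
Fenchel conjugate `(1/(2α)) max(q₁², q₂²)` as `g(v) = (α/2)(|v₁| + |v₂|)²`. -/
theorem conjugate_of_nonconvex_switching_penalty
    (α β : ℝ) (hα : 0 < α) (hαβ : α < β)
    (q : EuclideanSpace ℝ (Fin 2)) :
    IsLUB
      (Set.range fun v : EuclideanSpace ℝ (Fin 2) =>
        ⟪q, v⟫ - ((α - β) / 2 * ((v 0) ^ 2 + (v 1) ^ 2) +
          β / 2 * (|v 0| + |v 1|) ^ 2))
      (1 / (2 * α) * max ((q 0) ^ 2) ((q 1) ^ 2)) := by
  have inner_eq (v : EuclideanSpace ℝ (Fin 2)) : ⟪q, v⟫ = q 0 * v 0 + q 1 * v 1 := by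
    simp [PiLp.inner_apply, Fin.sum_univ_two, mul_comm]
  constructor
  · rintro _ ⟨v, rfl⟩
    simp only [inner_eq]
    obtain ⟨M, hM0, hM1, hM⟩ : ∃ M : ℝ, |q 0| ≤ M ∧ |q 1| ≤ M ∧
        M ^ 2 = max ((q 0) ^ 2) ((q 1) ^ 2) := by
      rcases le_total |q 0| |q 1| with h | h
      · exact ⟨|q 1|, h, le_rfl, by rw [max_eq_right (sq_le_sq.mpr h), sq_abs]⟩
      · exact ⟨|q 0|, le_rfl, h, by rw [max_eq_left (sq_le_sq.mpr h), sq_abs]⟩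
    rw [← hM]
    have h0 : q 0 * v 0 ≤ M * |v 0| :=
      (le_abs_self _).trans (abs_mul (q 0) (v 0) ▸ by gcongr)
    have h1 : q 1 * v 1 ≤ M * |v 1| :=
      (le_abs_self _).trans (abs_mul (q 1) (v 1) ▸ by gcongr)
    have cross : 0 ≤ (β - α) * (|v 0| * |v 1|) :=
      mul_nonneg (sub_nonneg.mpr hαβ.le) (by positivity)
    have young : M * (|v 0| + |v 1|) - α / 2 * (|v 0| + |v 1|) ^ 2 ≤
        1 / (2 * α) * M ^ 2 := by
      have square : 1 / (2 * α) * M ^ 2 -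
          (M * (|v 0| + |v 1|) - α / 2 * (|v 0| + |v 1|) ^ 2) =
          (M - α * (|v 0| + |v 1|)) ^ 2 / (2 * α) := by
        field_simp
        ring
      have : 0 ≤ (M - α * (|v 0| + |v 1|)) ^ 2 / (2 * α) := by positivity
      linarith
    rw [← sq_abs (v 0), ← sq_abs (v 1)]
    linarith
  · intro b hb
    have value_zero := hb ⟨!₂[q 0 / α, 0], rfl⟩
    have value_one := hb ⟨!₂[0, q 1 / α], rfl⟩
    simp only [inner_eq, Matrix.cons_val_zero, Matrix.cons_val_one,
      abs_zero, add_zero, zero_add, sq_abs] at value_zero value_one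
    rw [mul_max_of_nonneg _ _ (by positivity)]
    refine max_le (le_of_eq_of_le ?_ value_zero) (le_of_eq_of_le ?_ value_one) <;>
    · field_simp
      ring
end

section
/- Let 0 < α < β and define g_β : ℝ² → ℝ by g_β(v) = (α/2)(v_1² + v_2²) + β|v_1 v_2|, and g : ℝ² → ℝ by g(v) = (α/2)(|v_1| + |v_2|)². Then g is the lower convex envelope of g_β: (i) g(v) ≤ g_β(v) for all v ∈ ℝ²; and (ii) every convex function h : ℝ² → ℝ with h(v) ≤ g_β(v) for all v satisfies h(v) ≤ g(v) for all v. -/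
/-- For `0 < α < β`, the convex function `g(v) = (α/2)(|v₁| + |v₂|)²` is the
lower convex envelope of `g_β(v) = (α/2)(v₁² + v₂²) + β |v₁ v₂|`:
(i) `g ≤ g_β` pointwise, and (ii) any convex `h ≤ g_β` satisfies `h ≤ g`. -/
theorem switching_penalty_is_convex_envelope
    (α β : ℝ) (hα : 0 < α) (hαβ : α < β) :
    (∀ v : EuclideanSpace ℝ (Fin 2),
        α / 2 * (|v 0| + |v 1|) ^ 2 ≤
          α / 2 * ((v 0) ^ 2 + (v 1) ^ 2) + β * |v 0 * v 1|) ∧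
      (∀ h : EuclideanSpace ℝ (Fin 2) → ℝ,
        (∀ x y : EuclideanSpace ℝ (Fin 2), ∀ t : ℝ, 0 ≤ t → t ≤ 1 →
          h (t • x + (1 - t) • y) ≤ t * h x + (1 - t) * h y) →
        (∀ v, h v ≤ α / 2 * ((v 0) ^ 2 + (v 1) ^ 2) + β * |v 0 * v 1|) →
        ∀ v, h v ≤ α / 2 * (|v 0| + |v 1|) ^ 2) := by
  refine ⟨fun v => ?_, fun h hconv hle v => ?_⟩
  · have hab : |v 0 * v 1| = |v 0| * |v 1| := abs_mul _ _
    have hnn : 0 ≤ |v 0| * |v 1| := by positivity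
    rw [hab]
    nlinarith [sq_abs (v 0), sq_abs (v 1), mul_nonneg (sub_nonneg.2 hαβ.le) hnn]
  · have h0 := abs_nonneg (v 0)
    have h1 := abs_nonneg (v 1)
    rcases (add_nonneg h0 h1).eq_or_lt' with hs | hs
    · have e0 : v 0 = 0 := abs_eq_zero.1 (by linarith)
      have e1 : v 1 = 0 := abs_eq_zero.1 (by linarith)
      simpa [e0, e1] using hle v
    · set s := |v 0| + |v 1|
      have hsign (a : ℝ) : (SignType.sign a * s : ℝ) ^ 2 ≤ s ^ 2 := by
        rcases lt_trichotomy a 0 with ha | ha | ha <;> simp [ha, sq_nonneg]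
      have hx := hle !₂[(SignType.sign (v 0) * s : ℝ), 0]
      have hy := hle !₂[0, (SignType.sign (v 1) * s : ℝ)]
      simp only [Matrix.cons_val_zero, Matrix.cons_val_one, mul_zero, zero_mul,
        abs_zero, add_zero, zero_add, ne_eq, OfNat.ofNat_ne_zero, not_false_eq_true,
        zero_pow] at hx hy
      have ht0 : 0 ≤ |v 0| / s := by positivity
      have ht1 : |v 0| / s ≤ 1 := (div_le_one hs).2 (by linarith)
      have ht : 1 - |v 0| / s = |v 1| / s := by
        field_simp
        linarith
      have hmul (a : ℝ) : |a| / s * (SignType.sign a * s) = a := by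
        rw [mul_comm (SignType.sign a : ℝ), ← mul_assoc, div_mul_cancel₀ _ hs.ne', mul_comm,
          sign_mul_abs]
      have hv : (|v 0| / s) • !₂[(SignType.sign (v 0) * s : ℝ), 0] +
          (1 - |v 0| / s) • !₂[0, (SignType.sign (v 1) * s : ℝ)] = v := by
        ext i
        rw [ht]
        fin_cases i <;> simp [hmul]
      have hc := hconv !₂[(SignType.sign (v 0) * s : ℝ), 0]
        !₂[0, (SignType.sign (v 1) * s : ℝ)] _ ht0 ht1
      rw [hv] at hc
      have hα2 : 0 ≤ α / 2 := by positivity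
      have hx' := hx.trans (mul_le_mul_of_nonneg_left (hsign (v 0)) hα2)
      have hy' := hy.trans (mul_le_mul_of_nonneg_left (hsign (v 1)) hα2)
      calc h v ≤ _ := hc
        _ ≤ |v 0| / s * (α / 2 * s ^ 2) + (1 - |v 0| / s) * (α / 2 * s ^ 2) :=
          add_le_add (mul_le_mul_of_nonneg_left hx' ht0)
            (mul_le_mul_of_nonneg_left hy' (sub_nonneg.2 ht1))
        _ = α / 2 * s ^ 2 := by ring
end

section
/- For every q ∈ ℝ^N, the supremum of ⟨q, v⟩ − (α/2)‖v‖₂² over all vectors v ∈ ℝ^N having at most one nonzero component (i.e., v_i v_j = 0 for all i ≠ j) equals (1/(2α)) max_{1≤i≤N} q_i²; that is, the Fenchel conjugate of the switching-constrained quadratic functional g_∞ (equal to (α/2)‖v‖₂² on switching vectors and +∞ otherwise) equals g*. -/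
open scoped RealInnerProductSpace

/-- A vector with pairwise vanishing products of components has at most one nonzero component. -/
theorem exists_eq_single_of_pairwise_mul_eq_zero {N : ℕ} (hN : 0 < N)
    (v : EuclideanSpace ℝ (Fin N)) (hv : ∀ i j, i ≠ j → v i * v j = 0) :
    ∃ i c, v = EuclideanSpace.single i c := by
  by_cases h : ∃ i, v i ≠ 0
  · obtain ⟨i, hi⟩ := h
    refine ⟨i, v i, ?_⟩
    ext j
    rcases eq_or_ne j i with rfl | hji
    · simp
    · simpa [hji, hi] using hv i j hji.symm
  · push Not at h
    refine ⟨⟨0, hN⟩, 0, ?_⟩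
    ext j
    simp [h j]

theorem inner_single_sub_half_mul_norm_sq {N : ℕ} (α : ℝ) (q : EuclideanSpace ℝ (Fin N))
    (i : Fin N) (c : ℝ) :
    ⟪q, EuclideanSpace.single i c⟫ - α / 2 * ‖EuclideanSpace.single i c‖ ^ 2 =
      q i * c - α / 2 * c ^ 2 := by
  simp [EuclideanSpace.inner_single_right, mul_comm]

/-- The Fenchel conjugate of the switching-constrained quadratic functional
`g_∞` (equal to `(α/2)‖v‖₂²` for switching vectors `v`, i.e. those with
`v i * v j = 0` for `i ≠ j`, and `+∞` otherwise) is
`g*(q) = (1/(2α)) max_i (q i)²`: the supremum of `⟪q, v⟫ - (α/2)‖v‖₂²` over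
switching vectors `v` equals `(1/(2α)) max_i (q i)²`. -/
theorem conjugate_of_switching_constrained_quadratic
    (N : ℕ) (hN : 0 < N) (α : ℝ) (hα : 0 < α)
    (q : EuclideanSpace ℝ (Fin N)) :
    IsLUB
      {x : ℝ | ∃ v : EuclideanSpace ℝ (Fin N),
        (∀ i j, i ≠ j → v i * v j = 0) ∧ x = ⟪q, v⟫ - α / 2 * ‖v‖ ^ 2}
      (1 / (2 * α) * ⨆ i, (q i) ^ 2) := by
  have : Nonempty (Fin N) := ⟨⟨0, hN⟩⟩
  constructor
  · rintro x ⟨v, hv, rfl⟩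
    obtain ⟨i, c, rfl⟩ := exists_eq_single_of_pairwise_mul_eq_zero hN v hv
    rw [inner_single_sub_half_mul_norm_sq]
    calc q i * c - α / 2 * c ^ 2
        = 1 / (2 * α) * q i ^ 2 - 1 / (2 * α) * (q i - α * c) ^ 2 := by
          field_simp
          ring
      _ ≤ 1 / (2 * α) * q i ^ 2 := sub_le_self _ (by positivity)
      _ ≤ 1 / (2 * α) * ⨆ i, q i ^ 2 := by
          gcongr
          exact le_ciSup (f := fun i => q i ^ 2) (Set.finite_range _).bddAbove i
  · intro b hb
    obtain ⟨i, hi⟩ := exists_eq_ciSup_of_finite (f := fun i => q i ^ 2)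
    rw [← hi]
    refine hb ⟨EuclideanSpace.single i (q i / α), ?_, ?_⟩
    · intro j k hjk
      rcases eq_or_ne j i with rfl | hj
      · simp [hjk.symm]
      · simp [hj]
    · rw [inner_single_sub_half_mul_norm_sq]
      field_simp
      ring
end

section
/- The function g(v) = (α/2)(∑_{i=1}^N |v_i|)² is the lower convex envelope of the switching-constrained quadratic functional: (i) g(v) = (α/2)‖v‖₂² for every switching vector v (one with at most one nonzero component); and (ii) every convex function h : ℝ^N → ℝ satisfying h(v) ≤ (α/2)‖v‖₂² for all switching vectors v satisfies h(v) ≤ g(v) for all v ∈ ℝ^N. -/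
/-- The `ℓ¹` and Euclidean norms agree on vectors with at most one nonzero component. -/
theorem sq_sum_abs_eq_sq_norm_of_pairwise_mul_eq_zero {ι : Type*} [Fintype ι]
    (v : EuclideanSpace ℝ ι) (hv : ∀ i j, i ≠ j → v i * v j = 0) :
    (∑ i, |v i|) ^ 2 = ‖v‖ ^ 2 := by
  rw [EuclideanSpace.real_norm_sq_eq, sq, Finset.sum_mul_sum]
  refine Finset.sum_congr rfl fun i _ => ?_
  rw [Finset.sum_eq_single i]
  · rw [abs_mul_abs_self, sq]
  · intro j _ hji
    rw [← abs_mul, hv i j hji.symm, abs_zero]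
  · simp

/-- A convex function is bounded at `v ≠ 0` by any common bound for its values at the
points `c • eᵢ` with `|c| ≤ ∑ i, |v i|`. -/
theorem ConvexOn.le_of_forall_single_le {ι : Type*} [Fintype ι] [DecidableEq ι]
    {h : EuclideanSpace ℝ ι → ℝ} (hh : ConvexOn ℝ Set.univ h) (v : EuclideanSpace ℝ ι) {B : ℝ}
    (hv : 0 < ∑ i, |v i|)
    (hB : ∀ i c, |c| ≤ ∑ i, |v i| → h (EuclideanSpace.single i c) ≤ B) : h v ≤ B := by
  set S := ∑ i, |v i| with hS
  let w : ι → ℝ := fun i => |v i| / S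
  let p : ι → EuclideanSpace ℝ ι := fun i =>
    EuclideanSpace.single i ((SignType.sign (v i) : ℝ) * S)
  have hw : ∑ i, w i = 1 := by
    rw [← Finset.sum_div, ← hS, div_self hv.ne']
  have hw0 : ∀ i ∈ Finset.univ, 0 ≤ w i := fun i _ => by positivity
  have hvp : ∑ i, w i • p i = v := by
    ext j
    simp only [WithLp.ofLp_sum, Finset.sum_apply, PiLp.smul_apply, smul_eq_mul, w, p,
      PiLp.single_apply, mul_ite, mul_zero, Finset.sum_ite_eq, Finset.mem_univ, if_true]
    field_simp
    rw [mul_comm, sign_mul_abs]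
  have hp : ∀ i, h (p i) ≤ B := fun i => hB i _ <| by
    rw [abs_mul, abs_of_pos hv]
    refine mul_le_of_le_one_left hv.le ?_
    cases SignType.sign (v i) <;> simp
  calc h v = h (∑ i, w i • p i) := by rw [hvp]
    _ ≤ ∑ i, w i • h (p i) := hh.map_sum_le hw0 hw fun _ _ => Set.mem_univ _
    _ ≤ ∑ i, w i * B :=
      Finset.sum_le_sum fun i hi => mul_le_mul_of_nonneg_left (hp i) (hw0 i hi)
    _ = B := by rw [← Finset.sum_mul, hw, one_mul]

/-- `g(v) = (α/2)(∑ i, |v i|)²` is the lower convex envelope of the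
switching-constrained quadratic functional: (i) `g` agrees with `(α/2)‖v‖₂²`
on switching vectors (those with at most one nonzero component), and (ii) any
convex `h` lying below `(α/2)‖·‖₂²` on switching vectors lies below `g`
everywhere. -/
theorem switching_penalty_is_envelope_of_constrained_quadratic
    (N : ℕ) (hN : 0 < N) (α : ℝ) (hα : 0 < α) :
    (∀ v : EuclideanSpace ℝ (Fin N), (∀ i j, i ≠ j → v i * v j = 0) →
        α / 2 * (∑ i, |v i|) ^ 2 = α / 2 * ‖v‖ ^ 2) ∧
      (∀ h : EuclideanSpace ℝ (Fin N) → ℝ,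
        (∀ x y : EuclideanSpace ℝ (Fin N), ∀ t : ℝ, 0 ≤ t → t ≤ 1 →
          h (t • x + (1 - t) • y) ≤ t * h x + (1 - t) * h y) →
        (∀ v : EuclideanSpace ℝ (Fin N), (∀ i j, i ≠ j → v i * v j = 0) →
          h v ≤ α / 2 * ‖v‖ ^ 2) →
        ∀ v : EuclideanSpace ℝ (Fin N), h v ≤ α / 2 * (∑ i, |v i|) ^ 2) := by
  refine ⟨fun v hv => by rw [sq_sum_abs_eq_sq_norm_of_pairwise_mul_eq_zero v hv], ?_⟩
  intro h hconv hle v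
  have hh : ConvexOn ℝ Set.univ h := by
    refine ⟨convex_univ, fun x _ y _ a b ha hb hab => ?_⟩
    obtain rfl : b = 1 - a := by linarith
    exact hconv x y a ha (by linarith)
  rcases (Finset.sum_nonneg fun i _ => abs_nonneg (v i) : 0 ≤ ∑ i, |v i|).eq_or_lt with h0 | hpos
  · have hz : ∀ i, v i = 0 := fun i => by
      simpa using (Finset.sum_eq_zero_iff_of_nonneg fun i _ => abs_nonneg (v i)).1 h0.symm i
    have hsw : ∀ i j, i ≠ j → v i * v j = 0 := fun i j _ => by rw [hz i, zero_mul]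
    rw [sq_sum_abs_eq_sq_norm_of_pairwise_mul_eq_zero v hsw]
    exact hle v hsw
  · refine hh.le_of_forall_single_le v hpos fun i c hc => ?_
    refine (hle _ fun j k hjk => ?_).trans ?_
    · by_cases hj : j = i
      · have hk : k ≠ i := fun hk => hjk (hj.trans hk.symm)
        simp [hk]
      · simp [hj]
    · rw [PiLp.norm_single, Real.norm_eq_abs]
      gcongr
end

section
/- Let α, β > 0 and define g_0 : ℝ² → ℝ by g_0(v) = (α/2)(v_1² + v_2²) + β·|v_1 v_2|_0, where |s|_0 = 0 if s = 0 and |s|_0 = 1 otherwise. Then for every q ∈ ℝ², the supremum over v ∈ ℝ² of ⟨q, v⟩ − g_0(v) equals max( (1/(2α)) max(q_1², q_2²), (1/(2α))(q_1² + q_2²) − β ). In particular, if max(|q_1|, |q_2|) ≤ √(2αβ), this conjugate equals (1/(2α)) max(q_1², q_2²). -/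
open scoped RealInnerProductSpace Classical

/-- Young's inequality for the scalar quadratic `x ↦ (α/2) x²`. -/
lemma mul_sub_half_mul_sq_le {α : ℝ} (hα : 0 < α) (a x : ℝ) :
    a * x - α / 2 * x ^ 2 ≤ 1 / (2 * α) * a ^ 2 := by
  have h : 1 / (2 * α) * a ^ 2 - (a * x - α / 2 * x ^ 2) = (a - α * x) ^ 2 / (2 * α) := by
    field_simp
    ring
  have : 0 ≤ (a - α * x) ^ 2 / (2 * α) := by positivity
  linarith

/-- Equality in Young's inequality holds at `x = a / α`. -/
lemma mul_div_sub_half_mul_sq {α : ℝ} (hα : 0 < α) (a : ℝ) :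
    a * (a / α) - α / 2 * (a / α) ^ 2 = 1 / (2 * α) * a ^ 2 := by
  field_simp
  ring

lemma inner_euclideanSpace_fin_two (q v : EuclideanSpace ℝ (Fin 2)) :
    ⟪q, v⟫ = q 0 * v 0 + q 1 * v 1 := by
  simp [PiLp.inner_apply, Fin.sum_univ_two, mul_comm]

/-- The Fenchel conjugate of the `ℓ⁰`-switching functional
`g₀(v) = (α/2)(v₁² + v₂²) + β |v₁ v₂|₀` (where `|s|₀ = 0` if `s = 0` and `1`
otherwise) equals `max((1/(2α)) max(q₁², q₂²), (1/(2α))(q₁² + q₂²) - β)`;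
in particular it equals `(1/(2α)) max(q₁², q₂²)` when
`max(|q₁|, |q₂|) ≤ √(2αβ)`. -/
theorem conjugate_of_l0_switching_penalty
    (α β : ℝ) (hα : 0 < α) (hβ : 0 < β)
    (q : EuclideanSpace ℝ (Fin 2)) :
    IsLUB
      (Set.range fun v : EuclideanSpace ℝ (Fin 2) =>
        ⟪q, v⟫ - (α / 2 * ((v 0) ^ 2 + (v 1) ^ 2) +
          β * (if v 0 * v 1 = 0 then (0 : ℝ) else 1)))
      (max (1 / (2 * α) * max ((q 0) ^ 2) ((q 1) ^ 2))
        (1 / (2 * α) * ((q 0) ^ 2 + (q 1) ^ 2) - β)) ∧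
      (max |q 0| |q 1| ≤ Real.sqrt (2 * α * β) →
        max (1 / (2 * α) * max ((q 0) ^ 2) ((q 1) ^ 2))
            (1 / (2 * α) * ((q 0) ^ 2 + (q 1) ^ 2) - β) =
          1 / (2 * α) * max ((q 0) ^ 2) ((q 1) ^ 2)) := by
  have hc : (0 : ℝ) ≤ 1 / (2 * α) := by positivity
  refine ⟨⟨?_, ?_⟩, ?_⟩
  · rintro _ ⟨v, rfl⟩
    simp only [inner_euclideanSpace_fin_two]
    have h0 := mul_sub_half_mul_sq_le hα (q 0) (v 0)
    have h1 := mul_sub_half_mul_sq_le hα (q 1) (v 1)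
    split_ifs with h
    · apply le_max_of_le_left
      rw [mul_max_of_nonneg _ _ hc]
      rcases mul_eq_zero.mp h with h | h
      · apply le_max_of_le_right
        rw [h]
        linarith
      · apply le_max_of_le_left
        rw [h]
        linarith
    · apply le_max_of_le_right
      linarith
  · intro c hub
    have hval (x y : ℝ) : q 0 * x + q 1 * y - (α / 2 * (x ^ 2 + y ^ 2) +
        β * (if x * y = 0 then (0 : ℝ) else 1)) ≤ c := by
      have h := hub (Set.mem_range_self !₂[x, y])
      simp only [inner_euclideanSpace_fin_two] at h
      exact h
    have h0 := mul_div_sub_half_mul_sq hα (q 0)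
    have h1 := mul_div_sub_half_mul_sq hα (q 1)
    rw [mul_max_of_nonneg _ _ hc]
    refine max_le (max_le ?_ ?_) ?_
    · have := hval (q 0 / α) 0
      rw [if_pos (mul_zero _)] at this
      linarith
    · have := hval 0 (q 1 / α)
      rw [if_pos (zero_mul _)] at this
      linarith
    · have := hval (q 0 / α) (q 1 / α)
      split_ifs at this <;> linarith
  · intro h
    apply max_eq_left
    have hβα : 1 / (2 * α) * (2 * α * β) = β := by field_simp
    have hsq (a : ℝ) (ha : |a| ≤ √(2 * α * β)) : 1 / (2 * α) * a ^ 2 ≤ β := by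
      have ha' : a ^ 2 ≤ 2 * α * β := by
        rw [← sq_abs]
        exact (Real.le_sqrt (by positivity) (by positivity)).mp ha
      linarith [mul_le_mul_of_nonneg_left ha' hc]
    have h1 := hsq (q 1) ((le_max_right _ _).trans h)
    have := mul_le_mul_of_nonneg_left (le_max_left ((q 0) ^ 2) ((q 1) ^ 2)) hc
    linarith
end

section
/- Let U = L²((0,T); ℝ^N) with Lebesgue measure, let H be a real Hilbert space, K : U → H a continuous linear map, c, y^d ∈ H, and α > 0. Then the functional J(u) = (1/2)‖K u + c − y^d‖_H² + (α/2) ∫_0^T (∑_{i=1}^N |u_i(t)|)² dt attains its minimum over U, i.e., there exists ū ∈ U with J(ū) ≤ J(u) for all u ∈ U. -/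
open MeasureTheory

/-- A continuous convex function on a real Hilbert space with at least quadratic growth attains its
minimum. -/
theorem ConvexOn.exists_forall_le_of_sq_norm_le {E : Type*} [NormedAddCommGroup E]
    [InnerProductSpace ℝ E] [CompleteSpace E] {f : E → ℝ} (hf : ConvexOn ℝ Set.univ f)
    (hcont : Continuous f) {a : ℝ} (ha : 0 < a) (hgrowth : ∀ x, a * ‖x‖ ^ 2 ≤ f x) :
    ∃ x, ∀ y, f x ≤ f y := by
  have hbdd : BddBelow (Set.range f) := by
    refine ⟨0, ?_⟩
    rintro _ ⟨x, rfl⟩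
    exact le_trans (by positivity) (hgrowth x)
  set m := ⨅ x, f x with hm
  let C : ℕ → Set E := fun n => {x | f x ≤ m + 1 / ((n : ℝ) + 1)}
  have hC_convex (n : ℕ) : Convex ℝ (C n) := by
    simpa [C] using hf.convex_le (m + 1 / ((n : ℝ) + 1))
  have hmin (n : ℕ) : ∃ x ∈ C n, ∀ w ∈ C n, ‖x‖ ^ 2 ≤ inner ℝ x w := by
    have hne : (C n).Nonempty := by
      obtain ⟨x, hx⟩ := exists_lt_of_ciInf_lt
        (show ⨅ x, f x < m + 1 / ((n : ℝ) + 1) by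
          have : (0 : ℝ) < 1 / ((n : ℝ) + 1) := by positivity
          linarith)
      exact ⟨x, hx.le⟩
    have hclosed : IsClosed (C n) := isClosed_le hcont continuous_const
    obtain ⟨x, hx, hx'⟩ :=
      exists_norm_eq_iInf_of_complete_convex hne hclosed.isComplete (hC_convex n) 0
    rw [norm_eq_iInf_iff_real_inner_le_zero (hC_convex n) hx] at hx'
    refine ⟨x, hx, fun w hw => ?_⟩
    have h := hx' w hw
    rw [zero_sub, inner_neg_left, inner_sub_right, real_inner_self_eq_norm_sq] at h
    linarith
  choose x hxC hx using hmin
  have hanti : Antitone C := by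
    intro n k hnk y (hy : f y ≤ _)
    exact hy.trans (add_le_add_right (one_div_le_one_div_of_le (by positivity) (by gcongr)) m)
  have hdist {n k : ℕ} (hnk : n ≤ k) : ‖x k - x n‖ ^ 2 ≤ ‖x k‖ ^ 2 - ‖x n‖ ^ 2 := by
    have h := hx n (x k) (hanti hnk (hxC k))
    rw [norm_sub_sq_real, real_inner_comm]
    linarith
  have hmono : Monotone fun n => ‖x n‖ ^ 2 := by
    intro n k hnk
    have h := hdist hnk
    have := sq_nonneg ‖x k - x n‖
    change ‖x n‖ ^ 2 ≤ ‖x k‖ ^ 2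
    linarith
  have hbound : BddAbove (Set.range fun n => ‖x n‖ ^ 2) := by
    refine ⟨(m + 1) / a, ?_⟩
    rintro _ ⟨n, rfl⟩
    have h0 : f (x n) ≤ m + 1 / (((0 : ℕ) : ℝ) + 1) := hanti (Nat.zero_le n) (hxC n)
    have h1 := hgrowth (x n)
    norm_num at h0
    change ‖x n‖ ^ 2 ≤ _
    rw [le_div_iff₀ ha]
    linarith
  have hcauchy : CauchySeq x := by
    rw [Metric.cauchySeq_iff']
    intro ε hε
    obtain ⟨n, hn⟩ := exists_lt_of_lt_ciSup
      (show (⨆ n, ‖x n‖ ^ 2) - ε ^ 2 < ⨆ n, ‖x n‖ ^ 2 by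
        have : 0 < ε ^ 2 := by positivity
        linarith)
    refine ⟨n, fun k hk => ?_⟩
    have h1 : ‖x k‖ ^ 2 ≤ ⨆ n, ‖x n‖ ^ 2 := le_ciSup hbound k
    have h2 := hdist hk
    rw [dist_eq_norm]
    exact lt_of_pow_lt_pow_left₀ 2 hε.le (by linarith)
  obtain ⟨z, hz⟩ := cauchySeq_tendsto_of_complete hcauchy
  refine ⟨z, fun y => le_trans ?_ (ciInf_le hbdd y)⟩
  have hlim : Filter.Tendsto (fun n : ℕ => m + 1 / ((n : ℝ) + 1)) Filter.atTop (nhds m) := by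
    simpa using tendsto_one_div_add_atTop_nhds_zero_nat.const_add m
  exact le_of_tendsto_of_tendsto' ((hcont.tendsto z).comp hz) hlim hxC

theorem EuclideanSpace.norm_le_sum_abs {ι : Type*} [Fintype ι] (v : EuclideanSpace ℝ ι) :
    ‖v‖ ≤ ∑ i, |v i| := by
  rw [EuclideanSpace.norm_eq]
  refine Real.sqrt_le_iff.2 ⟨by positivity, ?_⟩
  simpa using Finset.sum_sq_le_sq_sum_of_nonneg (s := Finset.univ) (f := fun i => |v i|)
    fun i _ => abs_nonneg (v i)

theorem EuclideanSpace.lipschitzWith_sum_abs {ι : Type*} [Fintype ι] :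
    LipschitzWith (Fintype.card ι) fun v : EuclideanSpace ℝ ι => ∑ i, |v i| := by
  refine LipschitzWith.of_dist_le_mul fun v w => ?_
  rw [Real.dist_eq, dist_eq_norm, ← Finset.sum_sub_distrib]
  calc |∑ i, (|v i| - |w i|)| ≤ ∑ i, |(|v i| - |w i|)| := Finset.abs_sum_le_sum_abs _ _
    _ ≤ ∑ _i : ι, ‖v - w‖ := Finset.sum_le_sum fun i _ =>
        (abs_abs_sub_abs_le_abs_sub _ _).trans (PiLp.norm_apply_le (v - w) i)
    _ = _ := by simp

namespace MeasureTheory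

variable {X ι : Type*} [MeasurableSpace X] {μ : Measure X} [Fintype ι]

theorem integral_sum_abs_sq_eq_norm_sq_compLp (u : Lp (EuclideanSpace ℝ ι) 2 μ) :
    ∫ t, (∑ i, |u t i|) ^ 2 ∂μ =
      ‖EuclideanSpace.lipschitzWith_sum_abs.compLp (by simp) u‖ ^ 2 := by
  rw [← real_inner_self_eq_norm_sq, L2.inner_def]
  refine integral_congr_ae ?_
  filter_upwards [EuclideanSpace.lipschitzWith_sum_abs.coeFn_compLp (by simp) u] with t ht
  rw [real_inner_self_eq_norm_sq, ht]
  simp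

theorem integrable_sum_abs_sq (u : Lp (EuclideanSpace ℝ ι) 2 μ) :
    Integrable (fun t => (∑ i, |u t i|) ^ 2) μ :=
  have h : MemLp (fun t => ∑ i, |u t i|) 2 μ :=
    LipschitzWith.comp_memLp (g := fun v : EuclideanSpace ℝ ι => ∑ i, |v i|)
      EuclideanSpace.lipschitzWith_sum_abs (by simp) (Lp.memLp u)
  h.integrable_sq

theorem continuous_integral_sum_abs_sq :
    Continuous fun u : Lp (EuclideanSpace ℝ ι) 2 μ => ∫ t, (∑ i, |u t i|) ^ 2 ∂μ := by
  simp_rw [integral_sum_abs_sq_eq_norm_sq_compLp]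
  exact (EuclideanSpace.lipschitzWith_sum_abs.continuous_compLp (by simp)).norm.pow 2

theorem sq_norm_le_integral_sum_abs_sq (u : Lp (EuclideanSpace ℝ ι) 2 μ) :
    ‖u‖ ^ 2 ≤ ∫ t, (∑ i, |u t i|) ^ 2 ∂μ := by
  rw [← real_inner_self_eq_norm_sq, L2.inner_def]
  refine integral_mono (L2.integrable_inner u u) (integrable_sum_abs_sq u) fun t => ?_
  simp only [real_inner_self_eq_norm_sq]
  gcongr
  exact EuclideanSpace.norm_le_sum_abs _

theorem convexOn_integral_sum_abs_sq :
    ConvexOn ℝ Set.univ fun u : Lp (EuclideanSpace ℝ ι) 2 μ =>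
      ∫ t, (∑ i, |u t i|) ^ 2 ∂μ := by
  refine ⟨convex_univ, fun u _ v _ a b ha hb hab => ?_⟩
  simp only [smul_eq_mul]
  rw [← integral_const_mul, ← integral_const_mul,
    ← integral_add ((integrable_sum_abs_sq u).const_mul a) ((integrable_sum_abs_sq v).const_mul b)]
  refine integral_mono_ae (integrable_sum_abs_sq _)
    (((integrable_sum_abs_sq u).const_mul a).add ((integrable_sum_abs_sq v).const_mul b)) ?_
  filter_upwards [Lp.coeFn_add (a • u) (b • v), Lp.coeFn_smul a u, Lp.coeFn_smul b v]
    with t hadd hu hv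
  have hsum : ∑ i, |(a • u + b • v : Lp (EuclideanSpace ℝ ι) 2 μ) t i| ≤
      a * ∑ i, |u t i| + b * ∑ i, |v t i| := by
    rw [hadd, Pi.add_apply, hu, hv, Finset.mul_sum, Finset.mul_sum, ← Finset.sum_add_distrib]
    refine Finset.sum_le_sum fun i _ => (abs_add_le _ _).trans_eq ?_
    simp [abs_mul, abs_of_nonneg ha, abs_of_nonneg hb]
  calc _ ≤ (a * ∑ i, |u t i| + b * ∑ i, |v t i|) ^ 2 := by gcongr
    _ ≤ _ := (even_two.convexOn_pow (𝕜 := ℝ)).2 (Set.mem_univ _) (Set.mem_univ _) ha hb hab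

end MeasureTheory

/-- Existence of a minimizer for the switching-penalized tracking problem:
with `U = L²((0,T); ℝ^N)`, `H` a Hilbert space, `K : U → H` continuous linear
and affine solution operator `u ↦ K u + c`, the functional
`J(u) = (1/2)‖K u + c - y^d‖² + (α/2)∫₀ᵀ (∑ i, |u_i(t)|)² dt`
attains its minimum over `U`. -/
theorem exists_minimizer_switching_control
    (T : ℝ) (hT : 0 < T) (N : ℕ) (hN : 0 < N) (α : ℝ) (hα : 0 < α)
    (H : Type*) [NormedAddCommGroup H] [InnerProductSpace ℝ H] [CompleteSpace H]
    (K : Lp (EuclideanSpace ℝ (Fin N)) 2 (volume.restrict (Set.Ioo (0:ℝ) T)) →L[ℝ] H)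
    (c yd : H) :
    ∃ ubar : Lp (EuclideanSpace ℝ (Fin N)) 2 (volume.restrict (Set.Ioo (0:ℝ) T)),
      ∀ u : Lp (EuclideanSpace ℝ (Fin N)) 2 (volume.restrict (Set.Ioo (0:ℝ) T)),
        1 / 2 * ‖K ubar + c - yd‖ ^ 2 +
            α / 2 * ∫ t, (∑ i, |ubar t i|) ^ 2 ∂(volume.restrict (Set.Ioo (0:ℝ) T)) ≤
          1 / 2 * ‖K u + c - yd‖ ^ 2 +
            α / 2 * ∫ t, (∑ i, |u t i|) ^ 2 ∂(volume.restrict (Set.Ioo (0:ℝ) T)) := by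
  refine ConvexOn.exists_forall_le_of_sq_norm_le
    (f := fun u => 1 / 2 * ‖K u + c - yd‖ ^ 2 +
      α / 2 * ∫ t, (∑ i, |u t i|) ^ 2 ∂(volume.restrict (Set.Ioo (0:ℝ) T)))
    ?_ ?_ (half_pos hα) fun u => ?_
  · refine ConvexOn.add (ConvexOn.smul (c := (1 / 2 : ℝ)) (by norm_num) ?_)
      (convexOn_integral_sum_abs_sq.smul (half_pos hα).le)
    have h := (((convexOn_univ_norm (E := H)).translate_left (c - yd)).comp_linearMap
      K.toLinearMap).pow (fun _ _ => norm_nonneg _) 2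
    simpa [Function.comp_def, add_sub_assoc, Pi.pow_def] using h
  · exact (((K.continuous.add_const c).sub continuous_const).norm.pow 2 |>.const_mul _).add
      (continuous_integral_sum_abs_sq.const_mul _)
  · have h := mul_le_mul_of_nonneg_left (sq_norm_le_integral_sum_abs_sq u) (half_pos hα).le
    have := sq_nonneg ‖K u + c - yd‖
    linarith
end

section
/- Let U = L²((0,T); ℝ^N), H a real Hilbert space, K : U → H continuous linear with Hilbert-space adjoint K*, c, y^d ∈ H, and α > 0. A control ū ∈ U minimizes J(u) = (1/2)‖K u + c − y^d‖_H² + (α/2) ∫_0^T (∑_{i=1}^N |u_i(t)|)² dt over U if and only if, setting p̄ = −K*(K ū + c − y^d) ∈ U, the pointwise switching relation holds: for almost every t ∈ (0,T), ū(t) is a subgradient at p̄(t) of the function g*(q) = (1/(2α)) max_{1≤i≤N} q_i². In particular, for a.e. t, ū_j(t) = 0 whenever |p̄_j(t)| < max_i |p̄_i(t)|, and ū_j(t) = p̄_j(t)/α when the maximum is attained uniquely at j. -/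
open MeasureTheory
open scoped RealInnerProductSpace

section Pointwise

variable {ι : Type*} [Fintype ι]

lemma exists_forall_abs_le_and_iSup_sq [Nonempty ι] (q : EuclideanSpace ℝ ι) :
    ∃ j, (∀ i, |q i| ≤ |q j|) ∧ (⨆ i, (q i) ^ 2) = |q j| ^ 2 := by
  obtain ⟨j, hj⟩ := Finite.exists_max (fun i => |q i|)
  refine ⟨j, hj, le_antisymm (ciSup_le fun i => ?_) ?_⟩
  · rw [← sq_abs]
    exact pow_le_pow_left₀ (abs_nonneg _) (hj i) 2
  · rw [sq_abs]
    exact le_ciSup (f := fun i => (q i) ^ 2) (Set.finite_range _).bddAbove j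

lemma real_inner_eq_sum (v q : EuclideanSpace ℝ ι) : ⟪v, q⟫ = ∑ i, v i * q i := by
  simp [PiLp.inner_apply, mul_comm]

lemma real_inner_le_sum_abs_mul {M : ℝ} (v q : EuclideanSpace ℝ ι) (hM : ∀ i, |q i| ≤ M) :
    ⟪v, q⟫ ≤ (∑ i, |v i|) * M := by
  rw [real_inner_eq_sum, Finset.sum_mul]
  refine Finset.sum_le_sum fun i _ => (le_abs_self _).trans ?_
  rw [abs_mul]
  exact mul_le_mul_of_nonneg_left (hM i) (abs_nonneg _)

lemma mul_le_half_sq_add_half_sq {α : ℝ} (hα : 0 < α) (L M : ℝ) :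
    L * M ≤ α / 2 * L ^ 2 + 1 / (2 * α) * M ^ 2 := by
  have h : α / 2 * L ^ 2 + 1 / (2 * α) * M ^ 2 - L * M = (α * L - M) ^ 2 / (2 * α) := by
    field_simp
    ring
  have : 0 ≤ (α * L - M) ^ 2 / (2 * α) := by positivity
  linarith

/-- The Fenchel–Young inequality for the squared `ℓ¹` norm. -/
lemma real_inner_le_sq_sum_abs_add_iSup_sq [Nonempty ι] {α : ℝ} (hα : 0 < α)
    (v q : EuclideanSpace ℝ ι) :
    ⟪v, q⟫ ≤ α / 2 * (∑ i, |v i|) ^ 2 + 1 / (2 * α) * (⨆ i, (q i) ^ 2) := by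
  obtain ⟨j, hj, hs⟩ := exists_forall_abs_le_and_iSup_sq q
  rw [hs]
  exact (real_inner_le_sum_abs_mul v q hj).trans (mul_le_half_sq_add_half_sq hα _ _)

/-- A subgradient of `q ↦ (1/(2α)) max_i (q i)²` is characterized by equality in the
Fenchel–Young inequality. -/
lemma subgradient_iff_fenchel_young_eq [Nonempty ι] {α : ℝ} (hα : 0 < α)
    (v q : EuclideanSpace ℝ ι) :
    (∀ w : EuclideanSpace ℝ ι,
      1 / (2 * α) * (⨆ i, (w i) ^ 2) ≥ 1 / (2 * α) * (⨆ i, (q i) ^ 2) + ⟪v, w - q⟫) ↔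
    α / 2 * (∑ i, |v i|) ^ 2 + 1 / (2 * α) * (⨆ i, (q i) ^ 2) = ⟪v, q⟫ := by
  constructor
  · intro h
    refine le_antisymm ?_ (real_inner_le_sq_sum_abs_add_iSup_sq hα v q)
    set L := ∑ i, |v i| with hL
    have hL0 : 0 ≤ L := Finset.sum_nonneg fun i _ => abs_nonneg _
    let w : EuclideanSpace ℝ ι := WithLp.toLp 2 fun i => α * L * SignType.sign (v i)
    have hw : ⟪v, w⟫ = α * L ^ 2 := by
      rw [real_inner_eq_sum]
      have : ∀ i, v i * w i = α * L * |v i| := fun i => by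
        rw [← self_mul_sign (v i)]
        change v i * (α * L * SignType.sign (v i)) = _
        ring
      simp_rw [this]
      rw [← Finset.mul_sum, ← hL]
      ring
    have hsup : (⨆ i, (w i) ^ 2) ≤ (α * L) ^ 2 := by
      refine ciSup_le fun i => ?_
      change (α * L * SignType.sign (v i)) ^ 2 ≤ _
      rw [mul_pow]
      refine mul_le_of_le_one_right (sq_nonneg _) ?_
      cases SignType.sign (v i) <;> simp
    have h1 := h w
    rw [inner_sub_right, hw] at h1
    have h2 : 1 / (2 * α) * (⨆ i, (w i) ^ 2) ≤ α / 2 * L ^ 2 := by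
      calc _ ≤ 1 / (2 * α) * (α * L) ^ 2 := by gcongr
        _ = _ := by field_simp
    linarith
  · intro h w
    have := real_inner_le_sq_sum_abs_add_iSup_sq hα v w
    rw [inner_sub_right]
    linarith

lemma switching_of_fenchel_young_eq [Nonempty ι] {α : ℝ} (hα : 0 < α)
    {v q : EuclideanSpace ℝ ι}
    (h : α / 2 * (∑ i, |v i|) ^ 2 + 1 / (2 * α) * (⨆ i, (q i) ^ 2) = ⟪v, q⟫) :
    (∀ j, |q j| < (⨆ i, |q i|) → v j = 0) ∧
      ∀ j, (∀ i, i ≠ j → |q i| < |q j|) → v j = q j / α := by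
  obtain ⟨m, hm, hs⟩ := exists_forall_abs_le_and_iSup_sq q
  rw [hs] at h
  set L := ∑ i, |v i| with hL
  have h1 := real_inner_le_sum_abs_mul v q hm
  have h2 := mul_le_half_sq_add_half_sq hα L |q m|
  have hLM : ⟪v, q⟫ = L * |q m| := le_antisymm h1 (by linarith)
  have hαL : α * L = |q m| := by
    have e : α / 2 * L ^ 2 + 1 / (2 * α) * |q m| ^ 2 - L * |q m| =
        (α * L - |q m|) ^ 2 / (2 * α) := by
      field_simp
      ring
    rw [h, hLM, sub_self, eq_comm, div_eq_zero_iff] at e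
    rcases e with e | e
    · exact sub_eq_zero.1 (pow_eq_zero_iff two_ne_zero |>.1 e)
    · linarith
  have hterm : ∀ i, |v i| * |q m| = v i * q i := by
    have hle : ∀ i ∈ Finset.univ, v i * q i ≤ |v i| * |q m| := fun i _ =>
      (le_abs_self _).trans (by
        rw [abs_mul]
        exact mul_le_mul_of_nonneg_left (hm i) (abs_nonneg _))
    have hsum : ∑ i, v i * q i = ∑ i, |v i| * |q m| := by
      rw [← Finset.sum_mul, ← real_inner_eq_sum, hLM]
    exact fun i => ((Finset.sum_eq_sum_iff_of_le hle).1 hsum i (Finset.mem_univ i)).symm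
  have hzero : ∀ j, |q j| < |q m| → v j = 0 := by
    intro j hj
    by_contra hv
    have h3 : |v j| * |q j| < |v j| * |q m| := mul_lt_mul_of_pos_left hj (abs_pos.2 hv)
    rw [← abs_mul, hterm j] at h3
    exact absurd (le_abs_self _) (not_le.2 h3)
  refine ⟨fun j hj => hzero j (hj.trans_le (ciSup_le hm)), fun j hj => ?_⟩
  have hjm : m = j := by
    by_contra hne
    exact absurd (hm j) (not_le.2 (hj m hne))
  subst hjm
  have hLj : L = |v m| := by
    rw [hL]
    refine Finset.sum_eq_single m (fun i _ hi => ?_) (by simp)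
    rw [hzero i (hj i hi), abs_zero]
  rw [hLj] at hαL
  have h3 := hterm m
  rw [eq_div_iff hα.ne']
  by_cases hq : q m = 0
  · rw [hq, abs_zero] at hαL
    have hv : v m = 0 := abs_eq_zero.1 ((mul_eq_zero.1 hαL).resolve_left hα.ne')
    rw [hv, hq, zero_mul]
  · refine mul_right_cancel₀ hq ?_
    have h4 := abs_mul_abs_self (q m)
    calc v m * α * q m = α * (v m * q m) := by ring
      _ = α * |v m| * |q m| := by rw [← h3]; ring
      _ = q m * q m := by rw [hαL, h4]

/-- A measurable selection of subgradients of `q ↦ (1/(2α)) max_i (q i)²`, supported on a single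
coordinate where the maximum is attained. -/
lemma exists_measurable_fenchel_young_eq [Nonempty ι] [LinearOrder ι] {α : ℝ} (hα : 0 < α) :
    ∃ S : EuclideanSpace ℝ ι → EuclideanSpace ℝ ι, Measurable S ∧
      (∀ q, ‖S q‖ ≤ α⁻¹ * ‖q‖) ∧
      ∀ q, α / 2 * (∑ i, |S q i|) ^ 2 + 1 / (2 * α) * (⨆ i, (q i) ^ 2) = ⟪S q, q⟫ := by
  classical
  let S : EuclideanSpace ℝ ι → EuclideanSpace ℝ ι := fun q => WithLp.toLp 2 fun i =>
    if (∀ k, |q k| ≤ |q i|) ∧ ∀ k, k < i → |q k| < |q i| then q i / α else 0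
  have hS : ∀ q, ∃ j, (⨆ i, (q i) ^ 2) = |q j| ^ 2 ∧ S q = PiLp.single 2 j (q j / α) := by
    intro q
    obtain ⟨m, hm, hs⟩ := exists_forall_abs_le_and_iSup_sq q
    obtain ⟨j, hj, hjmin⟩ := Finset.exists_min_image
      (Finset.univ.filter fun j => |q m| ≤ |q j|) id ⟨m, by simp⟩
    simp only [Finset.mem_filter, Finset.mem_univ, true_and, id] at hj hjmin
    have hqj : |q j| = |q m| := le_antisymm (hm j) hj
    refine ⟨j, by rw [hs, hqj], ?_⟩
    ext i
    simp only [S, PiLp.single_apply]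
    by_cases hij : i = j
    · subst hij
      rw [if_pos, if_pos rfl]
      refine ⟨fun k => (hm k).trans hj, fun k hk => ?_⟩
      rw [hqj]
      by_contra hlt
      exact absurd (hjmin k (not_lt.1 hlt)) (not_le.2 hk)
    · rw [if_neg, if_neg hij]
      rintro ⟨h1, h2⟩
      rcases lt_or_gt_of_ne hij with hlt | hlt
      · exact absurd (hjmin i (h1 m)) (not_le.2 hlt)
      · exact absurd (h2 j hlt) (not_lt.2 ((hm i).trans hj))
  have hcoord : ∀ i, Measurable fun q : EuclideanSpace ℝ ι => q i := fun i => by fun_prop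
  have habs : ∀ i, Measurable fun q : EuclideanSpace ℝ ι => |q i| := fun i => (hcoord i).abs
  refine ⟨S, ?_, fun q => ?_, fun q => ?_⟩
  · refine (WithLp.measurable_toLp 2 (ι → ℝ)).comp (measurable_pi_iff.2 fun i => ?_)
    refine Measurable.ite ?_ ((hcoord i).div_const α) measurable_const
    refine MeasurableSet.inter (s₁ := {q : EuclideanSpace ℝ ι | ∀ k, |q k| ≤ |q i|})
      (s₂ := {q : EuclideanSpace ℝ ι | ∀ k, k < i → |q k| < |q i|}) ?_ ?_
    · simp only [Set.ofPred_forall]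
      exact MeasurableSet.iInter fun k => measurableSet_le (habs k) (habs i)
    · simp only [Set.ofPred_forall]
      exact MeasurableSet.iInter fun k => MeasurableSet.iInter fun _ =>
        measurableSet_lt (habs k) (habs i)
  · obtain ⟨j, -, hj⟩ := hS q
    rw [hj, PiLp.norm_single, norm_div, Real.norm_of_nonneg hα.le, div_eq_inv_mul]
    exact mul_le_mul_of_nonneg_left (PiLp.norm_apply_le q j) (inv_nonneg.2 hα.le)
  · obtain ⟨j, hs, hj⟩ := hS q
    have hsum : ∑ i, |S q i| = |q j| / α := by
      rw [Finset.sum_eq_single j (fun i _ hi => by simp [hj, hi]) (by simp)]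
      simp [hj, abs_div, abs_of_pos hα]
    have hinner : ⟪S q, q⟫ = |q j| ^ 2 / α := by
      rw [real_inner_eq_sum, Finset.sum_eq_single j (fun i _ hi => by simp [hj, hi]) (by simp)]
      simp [hj]
      ring
    rw [hs, hsum, hinner]
    rw [div_pow]
    field_simp
    rw [sq_abs]
    ring

lemma sq_sum_abs_convex (v w : EuclideanSpace ℝ ι) {a b : ℝ} (ha : 0 ≤ a) (hb : 0 ≤ b)
    (hab : a + b = 1) :
    (∑ i, |(a • v + b • w) i|) ^ 2 ≤ a * (∑ i, |v i|) ^ 2 + b * (∑ i, |w i|) ^ 2 := by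
  have h1 : ∑ i, |(a • v + b • w) i| ≤ a * ∑ i, |v i| + b * ∑ i, |w i| := by
    rw [Finset.mul_sum, Finset.mul_sum, ← Finset.sum_add_distrib]
    refine Finset.sum_le_sum fun i _ => (abs_add_le _ _).trans ?_
    simp [abs_mul, abs_of_nonneg ha, abs_of_nonneg hb]
  refine (pow_le_pow_left₀ (Finset.sum_nonneg fun i _ => abs_nonneg _) h1 2).trans ?_
  exact (convexOn_pow 2).2 (Finset.sum_nonneg fun i _ => abs_nonneg (v i))
    (Finset.sum_nonneg fun i _ => abs_nonneg (w i)) ha hb hab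

end Pointwise

/-- First-order optimality condition for a least-squares term plus a convex function. -/
lemma isMinimizer_iff_inner_le {E H : Type*} [NormedAddCommGroup E] [InnerProductSpace ℝ E]
    [CompleteSpace E] [NormedAddCommGroup H] [InnerProductSpace ℝ H] [CompleteSpace H]
    (K : E →L[ℝ] H) (b : H) {Φ : E → ℝ} (hΦ : ConvexOn ℝ Set.univ Φ) (x : E) :
    (∀ u, 1 / 2 * ‖K x + b‖ ^ 2 + Φ x ≤ 1 / 2 * ‖K u + b‖ ^ 2 + Φ u) ↔
      ∀ u, ⟪-(ContinuousLinearMap.adjoint K (K x + b)), u - x⟫ ≤ Φ u - Φ x := by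
  have hexp : ∀ d, ‖K (x + d) + b‖ ^ 2 = ‖K x + b‖ ^ 2 +
      2 * ⟪ContinuousLinearMap.adjoint K (K x + b), d⟫ + ‖K d‖ ^ 2 := by
    intro d
    rw [ContinuousLinearMap.adjoint_inner_left, ← norm_add_sq_real, map_add]
    congr 2
    abel
  constructor
  · intro h u
    set X := Φ u - Φ x - ⟪-(ContinuousLinearMap.adjoint K (K x + b)), u - x⟫ with hX
    suffices 0 ≤ X by linarith
    have key : ∀ s : ℝ, 0 < s → s ≤ 1 → 0 ≤ X + s * (1 / 2 * ‖K (u - x)‖ ^ 2) := by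
      intro s hs hs1
      have h1 := h (x + s • (u - x))
      have h2 := hΦ.2 (Set.mem_univ x) (Set.mem_univ u) (sub_nonneg.2 hs1) hs.le
        (sub_add_cancel 1 s)
      have h3 : (1 - s) • x + s • u = x + s • (u - x) := by
        rw [sub_smul, one_smul, smul_sub]
        abel
      rw [h3] at h2
      rw [hexp, inner_smul_right, map_smul, norm_smul, mul_pow, Real.norm_of_nonneg hs.le] at h1
      simp only [smul_eq_mul] at h2
      rw [inner_neg_left] at hX
      refine nonneg_of_mul_nonneg_right (a := s) ?_ hs
      rw [hX]
      nlinarith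
    have hlim : Filter.Tendsto (fun s : ℝ => X + s * (1 / 2 * ‖K (u - x)‖ ^ 2))
        (nhdsWithin 0 (Set.Ioi 0)) (nhds X) := by
      have : Continuous fun s : ℝ => X + s * (1 / 2 * ‖K (u - x)‖ ^ 2) := by fun_prop
      simpa using (this.tendsto 0).mono_left nhdsWithin_le_nhds
    refine ge_of_tendsto hlim ?_
    filter_upwards [Ioc_mem_nhdsGT (zero_lt_one' ℝ)] with s hs using key s hs.1 hs.2
  · intro h u
    have h1 := hexp (u - x)
    rw [add_sub_cancel] at h1
    have h2 := h u
    rw [inner_neg_left] at h2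
    nlinarith [sq_nonneg ‖K (u - x)‖]

section Integral

variable {ι X : Type*} [Fintype ι] {m : MeasurableSpace X} {μ : Measure X}

lemma integrable_sq_sum_abs (u : Lp (EuclideanSpace ℝ ι) 2 μ) :
    Integrable (fun t => (∑ i, |u t i|) ^ 2) μ := by
  refine MemLp.integrable_sq (memLp_finsetSum _ fun i _ => ?_)
  refine (Lp.memLp u).of_le ?_ (Filter.Eventually.of_forall fun t => ?_)
  · have hc : Continuous fun v : EuclideanSpace ℝ ι => |v i| := by fun_prop
    exact hc.comp_aestronglyMeasurable (Lp.aestronglyMeasurable u)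
  · rw [Real.norm_eq_abs, abs_abs]
    exact PiLp.norm_apply_le (u t) i

lemma convexOn_integral_sq_sum_abs {α : ℝ} (hα : 0 < α) :
    ConvexOn ℝ Set.univ fun u : Lp (EuclideanSpace ℝ ι) 2 μ =>
      α / 2 * ∫ t, (∑ i, |u t i|) ^ 2 ∂μ := by
  refine ConvexOn.smul (c := α / 2) (by positivity) ⟨convex_univ, ?_⟩
  intro u _ v _ a b ha hb hab
  simp only [smul_eq_mul]
  have hu := (integrable_sq_sum_abs u).const_mul a
  have hv := (integrable_sq_sum_abs v).const_mul b
  rw [← integral_const_mul, ← integral_const_mul, ← integral_add hu hv]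
  refine integral_mono_ae (integrable_sq_sum_abs _) (hu.add hv) ?_
  filter_upwards [Lp.coeFn_add (a • u) (b • v), Lp.coeFn_smul a u, Lp.coeFn_smul b v]
    with t h1 h2 h3
  rw [h1, Pi.add_apply, h2, h3]
  exact sq_sum_abs_convex (u t) (v t) ha hb hab

lemma ae_fenchel_young_eq_iff_inner_le [Nonempty ι] [LinearOrder ι] {α : ℝ} (hα : 0 < α)
    (v p : Lp (EuclideanSpace ℝ ι) 2 μ) :
    (∀ u : Lp (EuclideanSpace ℝ ι) 2 μ, ⟪p, u - v⟫ ≤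
      α / 2 * (∫ t, (∑ i, |u t i|) ^ 2 ∂μ) - α / 2 * ∫ t, (∑ i, |v t i|) ^ 2 ∂μ) ↔
    ∀ᵐ t ∂μ, α / 2 * (∑ i, |v t i|) ^ 2 + 1 / (2 * α) * (⨆ i, (p t i) ^ 2) = ⟪v t, p t⟫ := by
  let F : Lp (EuclideanSpace ℝ ι) 2 μ → X → ℝ := fun u t =>
    α / 2 * (∑ i, |u t i|) ^ 2 - α / 2 * (∑ i, |v t i|) ^ 2 - ⟪p t, (u - v : Lp _ 2 μ) t⟫
  have hφ : ∀ u : Lp (EuclideanSpace ℝ ι) 2 μ,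
      Integrable (fun t => α / 2 * (∑ i, |u t i|) ^ 2) μ :=
    fun u => (integrable_sq_sum_abs u).const_mul _
  have hFint : ∀ u, Integrable (F u) μ := fun u =>
    ((hφ u).sub (hφ v)).sub (L2.integrable_inner p (u - v))
  have hF : ∀ u, ∫ t, F u t ∂μ = α / 2 * (∫ t, (∑ i, |u t i|) ^ 2 ∂μ) -
      α / 2 * (∫ t, (∑ i, |v t i|) ^ 2 ∂μ) - ⟪p, u - v⟫ := by
    intro u
    rw [L2.inner_def, ← integral_const_mul, ← integral_const_mul, ← integral_sub (hφ u) (hφ v)]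
    exact integral_sub ((hφ u).sub (hφ v)) (L2.integrable_inner p (u - v))
  have hsub : ∀ u, ∀ᵐ t ∂μ, F u t = α / 2 * (∑ i, |u t i|) ^ 2 - ⟪u t, p t⟫ -
      (α / 2 * (∑ i, |v t i|) ^ 2 - ⟪v t, p t⟫) := by
    intro u
    filter_upwards [Lp.coeFn_sub u v] with t ht
    simp only [F]
    rw [ht, Pi.sub_apply, inner_sub_right, real_inner_comm (u t), real_inner_comm (v t)]
    ring
  constructor
  · intro h
    obtain ⟨S, hSm, hSle, hS⟩ := exists_measurable_fenchel_young_eq (ι := ι) hα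
    have hmem : MemLp (fun t => S (p t)) 2 μ :=
      (Lp.memLp p).of_le_mul
        (hSm.comp_aemeasurable (Lp.aestronglyMeasurable p).aemeasurable).aestronglyMeasurable
        (Filter.Eventually.of_forall fun t => hSle (p t))
    have hle : ∀ᵐ t ∂μ, F (hmem.toLp _) t = -(α / 2 * (∑ i, |v t i|) ^ 2 +
        1 / (2 * α) * (⨆ i, (p t i) ^ 2) - ⟪v t, p t⟫) := by
      filter_upwards [hsub (hmem.toLp _), hmem.coeFn_toLp] with t h1 h2
      rw [h1, h2]
      linarith [hS (p t)]
    have hnonneg : 0 ≤ᵐ[μ] fun t => -F (hmem.toLp _) t := by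
      filter_upwards [hle] with t ht
      rw [Pi.zero_apply, ht]
      linarith [real_inner_le_sq_sum_abs_add_iSup_sq hα (v t) (p t)]
    have hzero : ∫ t, -F (hmem.toLp _) t ∂μ = 0 := by
      refine le_antisymm ?_ (integral_nonneg_of_ae hnonneg)
      rw [integral_neg, hF]
      linarith [h (hmem.toLp _)]
    rw [integral_eq_zero_iff_of_nonneg_ae hnonneg (hFint _).neg] at hzero
    filter_upwards [hzero, hle] with t h1 h2
    rw [Pi.zero_apply, h2] at h1
    linarith
  · intro h u
    have : 0 ≤ ∫ t, F u t ∂μ := by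
      refine integral_nonneg_of_ae ?_
      filter_upwards [h, hsub u] with t h1 h2
      rw [Pi.zero_apply, h2]
      linarith [real_inner_le_sq_sum_abs_add_iSup_sq hα (u t) (p t)]
    rw [hF] at this
    linarith

end Integral

/-- First-order optimality conditions in primal-dual form: `ū ∈ U = L²((0,T);ℝ^N)`
minimizes `J(u) = (1/2)‖K u + c - y^d‖² + (α/2)∫₀ᵀ (∑ i, |u_i(t)|)² dt` if and
only if, with the adjoint state `p̄ = -K*(K ū + c - y^d)`, for a.e. `t` the
vector `ū(t)` is a subgradient of `g*(q) = (1/(2α)) max_i (q i)²` at `p̄(t)`.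
In particular, a minimizer satisfies the pointwise switching relations:
`ū_j(t) = 0` whenever `|p̄_j(t)| < max_i |p̄_i(t)|`, and `ū_j(t) = p̄_j(t)/α`
when the maximum is attained uniquely at `j`. -/
theorem optimality_condition_switching_control
    (T : ℝ) (hT : 0 < T) (N : ℕ) (hN : 0 < N) (α : ℝ) (hα : 0 < α)
    (H : Type*) [NormedAddCommGroup H] [InnerProductSpace ℝ H] [CompleteSpace H]
    (K : Lp (EuclideanSpace ℝ (Fin N)) 2 (volume.restrict (Set.Ioo (0:ℝ) T)) →L[ℝ] H)
    (c yd : H)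
    (ubar pbar : Lp (EuclideanSpace ℝ (Fin N)) 2 (volume.restrict (Set.Ioo (0:ℝ) T)))
    (hpbar : pbar = -(ContinuousLinearMap.adjoint K (K ubar + c - yd))) :
    ((∀ u : Lp (EuclideanSpace ℝ (Fin N)) 2 (volume.restrict (Set.Ioo (0:ℝ) T)),
        1 / 2 * ‖K ubar + c - yd‖ ^ 2 +
            α / 2 * (∫ t, (∑ i, |ubar t i|) ^ 2 ∂(volume.restrict (Set.Ioo (0:ℝ) T))) ≤
          1 / 2 * ‖K u + c - yd‖ ^ 2 +
            α / 2 * (∫ t, (∑ i, |u t i|) ^ 2 ∂(volume.restrict (Set.Ioo (0:ℝ) T)))) ↔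
      (∀ᵐ t ∂(volume.restrict (Set.Ioo (0:ℝ) T)),
        ∀ w : EuclideanSpace ℝ (Fin N),
          1 / (2 * α) * (⨆ i, (w i) ^ 2) ≥
            1 / (2 * α) * (⨆ i, (pbar t i) ^ 2) + ⟪ubar t, w - pbar t⟫)) ∧
    ((∀ u : Lp (EuclideanSpace ℝ (Fin N)) 2 (volume.restrict (Set.Ioo (0:ℝ) T)),
        1 / 2 * ‖K ubar + c - yd‖ ^ 2 +
            α / 2 * (∫ t, (∑ i, |ubar t i|) ^ 2 ∂(volume.restrict (Set.Ioo (0:ℝ) T))) ≤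
          1 / 2 * ‖K u + c - yd‖ ^ 2 +
            α / 2 * (∫ t, (∑ i, |u t i|) ^ 2 ∂(volume.restrict (Set.Ioo (0:ℝ) T)))) →
      ∀ᵐ t ∂(volume.restrict (Set.Ioo (0:ℝ) T)),
        (∀ j, |pbar t j| < (⨆ i, |pbar t i|) → ubar t j = 0) ∧
        ∀ j, (∀ i, i ≠ j → |pbar t i| < |pbar t j|) → ubar t j = pbar t j / α) := by
  have : Nonempty (Fin N) := ⟨⟨0, hN⟩⟩
  have hmin := isMinimizer_iff_inner_le K (c - yd) (convexOn_integral_sq_sum_abs hα) ubar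
  simp only [← add_sub_assoc, ← hpbar] at hmin
  have hiff := hmin.trans (ae_fenchel_young_eq_iff_inner_le hα ubar pbar)
  refine ⟨hiff.trans ?_, fun h => ?_⟩
  · simp only [subgradient_iff_fenchel_young_eq hα]
  · filter_upwards [hiff.1 h] with t ht using switching_of_fenchel_young_eq hα ht
end
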